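/- Let C be a collection of subsets of a set X that is closed under finite union and finite intersection, and let k ≥ 1. Then: (a) L ∈ C(2k−1) if and only if there exist L_1, L_2, …, L_{2k−1} ∈ C with L_1 ⊇ L_2 ⊇ ⋯ ⊇ L_{2k−1} and L = ⋃_{i=1}^{k−1} (L_{2i−1} \ L_{2i}) ∪ L_{2k−1}; (b) L ∈ C(2k) if and only if there exist L_1, L_2, …, L_{2k} ∈ C with L_1 ⊇ L_2 ⊇ ⋯ ⊇ L_{2k} and L = ⋃_{i=1}^{k} (L_{2i−1} \ L_{2i}). -/

import Mathlib

/-- The `k`-th level of the boolean hierarchy over a class `C`: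
`C(k) = {L₁ Δ L₂ Δ ⋯ Δ L_k | L₁, …, L_k ∈ C}` (`Δ` is symmetric difference). -/
def boolLevel {X : Type*} (C : Set (Set X)) (k : ℕ) : Set (Set X) :=
  {L | ∃ Ls : List (Set X), Ls.length = k ∧ (∀ M ∈ Ls, M ∈ C) ∧
    L = Ls.foldr symmDiff ∅}

/-- Insert a set into a decreasing chain of sets, preserving the iterated symmetric difference. -/
def chainInsert {X : Type*} : Set X → List (Set X) → List (Set X)
  | P, [] => [P]
  | P, M :: l => (P ∪ M) :: chainInsert (P ∩ M) l

theorem length_chainInsert {X : Type*} (P : Set X) (l : List (Set X)) :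
    (chainInsert P l).length = l.length + 1 := by
  induction l generalizing P with
  | nil => rfl
  | cons M l ih => simp [chainInsert, ih]

theorem mem_of_mem_chainInsert {X : Type*} {C : Set (Set X)}
    (hUnion : ∀ P ∈ C, ∀ Q ∈ C, P ∪ Q ∈ C) (hInter : ∀ P ∈ C, ∀ Q ∈ C, P ∩ Q ∈ C)
    {P : Set X} {l : List (Set X)} (hP : P ∈ C) (hl : ∀ M ∈ l, M ∈ C) :
    ∀ M ∈ chainInsert P l, M ∈ C := by
  induction l generalizing P with
  | nil => simpa [chainInsert] using hP
  | cons M l ih =>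
    rw [List.forall_mem_cons] at hl
    simp only [chainInsert, List.forall_mem_cons]
    exact ⟨hUnion _ hP _ hl.1, ih (hInter _ hP _ hl.1) hl.2⟩

theorem subset_of_mem_chainInsert {X : Type*} {P S : Set X} {l : List (Set X)}
    (hP : P ⊆ S) (hl : ∀ M ∈ l, M ⊆ S) : ∀ M ∈ chainInsert P l, M ⊆ S :=
  mem_of_mem_chainInsert (C := {M | M ⊆ S}) (fun _ hA _ hB => Set.union_subset hA hB)
    (fun _ hA _ _ => Set.inter_subset_left.trans hA) hP hl

theorem pairwise_chainInsert {X : Type*} {l : List (Set X)}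
    (hl : l.Pairwise (fun A B => B ⊆ A)) (P : Set X) :
    (chainInsert P l).Pairwise (fun A B => B ⊆ A) := by
  induction l generalizing P with
  | nil => simp [chainInsert]
  | cons M l ih =>
    rw [List.pairwise_cons] at hl
    simp only [chainInsert, List.pairwise_cons]
    exact ⟨subset_of_mem_chainInsert (Set.inter_subset_left.trans Set.subset_union_left)
      fun N hN => (hl.1 N hN).trans Set.subset_union_right, ih hl.2 _⟩

theorem foldr_symmDiff_chainInsert {X : Type*} (P : Set X) (l : List (Set X)) :
    (chainInsert P l).foldr symmDiff ∅ = symmDiff P (l.foldr symmDiff ∅) := by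
  induction l generalizing P with
  | nil => rfl
  | cons M l ih =>
    simp only [chainInsert, List.foldr_cons, ih]
    ext x
    simp only [Set.mem_symmDiff, Set.mem_union, Set.mem_inter_iff]
    tauto

theorem exists_chain_foldr_symmDiff_eq {X : Type*} {C : Set (Set X)}
    (hUnion : ∀ P ∈ C, ∀ Q ∈ C, P ∪ Q ∈ C) (hInter : ∀ P ∈ C, ∀ Q ∈ C, P ∩ Q ∈ C)
    (l : List (Set X)) (hl : ∀ M ∈ l, M ∈ C) :
    ∃ l' : List (Set X), l'.length = l.length ∧ (∀ M ∈ l', M ∈ C) ∧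
      l'.Pairwise (fun A B => B ⊆ A) ∧ l'.foldr symmDiff ∅ = l.foldr symmDiff ∅ := by
  induction l with
  | nil => exact ⟨[], by simp⟩
  | cons P l ih =>
    rw [List.forall_mem_cons] at hl
    obtain ⟨l', h_len, h_mem, h_pw, h_fold⟩ := ih hl.2
    exact ⟨chainInsert P l', by simp [length_chainInsert, h_len],
      mem_of_mem_chainInsert hUnion hInter hl.1 h_mem, pairwise_chainInsert h_pw P,
      by simp [foldr_symmDiff_chainInsert, h_fold]⟩

/-- The symmetric difference of the first `n` terms of a sequence of sets. -/
def symmDiffRange {X : Type*} (f : ℕ → Set X) : ℕ → Set X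
  | 0 => ∅
  | n + 1 => symmDiff (symmDiffRange f n) (f n)

theorem foldr_symmDiff_map_range {X : Type*} (f : ℕ → Set X) (n : ℕ) (S : Set X) :
    ((List.range n).map f).foldr symmDiff S = symmDiff (symmDiffRange f n) S := by
  induction n generalizing S with
  | zero => simp [symmDiffRange, ← Set.bot_eq_empty]
  | succ n ih => simp [List.range_succ, ih, symmDiffRange, symmDiff_assoc]

theorem mem_boolLevel_iff_exists_chain {X : Type*} {C : Set (Set X)}
    (hUnion : ∀ P ∈ C, ∀ Q ∈ C, P ∪ Q ∈ C) (hInter : ∀ P ∈ C, ∀ Q ∈ C, P ∩ Q ∈ C)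
    (n : ℕ) (L : Set X) :
    L ∈ boolLevel C n ↔ ∃ f : ℕ → Set X, (∀ i < n, f i ∈ C) ∧
      (∀ i j, i ≤ j → j < n → f j ⊆ f i) ∧ L = symmDiffRange f n := by
  have h_fold (f : ℕ → Set X) :
      ((List.range n).map f).foldr symmDiff ∅ = symmDiffRange f n := by
    rw [foldr_symmDiff_map_range, ← Set.bot_eq_empty, symmDiff_bot]
  constructor
  · rintro ⟨l, rfl, hl, rfl⟩
    obtain ⟨l', h_len, h_mem, h_pw, h_eq⟩ :=
      exists_chain_foldr_symmDiff_eq hUnion hInter l hl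
    have h_map : (List.range l.length).map (fun i => l'.getD i ∅) = l' := by
      apply List.ext_getElem
      · simp [h_len]
      · intro i h₁ h₂
        simp [h₂]
    refine ⟨fun i => l'.getD i ∅, fun i hi => ?_, fun i j hij hj => ?_, ?_⟩
    · rw [← h_len] at hi
      simp [hi, h_mem]
    · rw [← h_len] at hj
      rcases hij.eq_or_lt with rfl | hlt
      · exact subset_rfl
      · simpa [hj, hlt.trans hj] using List.pairwise_iff_getElem.mp h_pw i j _ hj hlt
    · rw [← h_fold, h_map, h_eq]
  · rintro ⟨f, hf, -, rfl⟩
    exact ⟨(List.range n).map f, by simp, by simpa using hf, (h_fold f).symm⟩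

theorem symmDiff_iUnion_sdiff_eq_union {X : Type*} {f : ℕ → Set X} {k : ℕ} {S : Set X}
    (hS : ∀ i < k, S ⊆ f (2 * i + 1)) :
    symmDiff (⋃ i ∈ Finset.range k, f (2 * i) \ f (2 * i + 1)) S =
      (⋃ i ∈ Finset.range k, f (2 * i) \ f (2 * i + 1)) ∪ S := by
  refine Disjoint.symmDiff_eq_sup ?_
  simp only [Set.disjoint_iUnion_left, Finset.mem_range]
  exact fun i hi => Set.disjoint_sdiff_left.mono_right (hS i hi)

theorem symmDiffRange_two_mul {X : Type*} {f : ℕ → Set X} {k : ℕ}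
    (hf : ∀ i j, i ≤ j → j < 2 * k → f j ⊆ f i) :
    symmDiffRange f (2 * k) = ⋃ i ∈ Finset.range k, f (2 * i) \ f (2 * i + 1) := by
  induction k with
  | zero => simp [symmDiffRange]
  | succ k ih =>
    have h_last : symmDiff (f (2 * k)) (f (2 * k + 1)) = f (2 * k) \ f (2 * k + 1) :=
      symmDiff_of_ge (hf _ _ (by lia) (by lia))
    rw [show 2 * (k + 1) = 2 * k + 1 + 1 by ring, symmDiffRange, symmDiffRange,
      ih fun i j hij hj => hf i j hij (by lia), symmDiff_assoc, h_last,
      symmDiff_iUnion_sdiff_eq_union fun i hi =>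
        Set.sdiff_subset.trans (hf _ _ (by lia) (by lia)),
      Finset.range_add_one, Finset.set_biUnion_insert, Set.union_comm]

theorem symmDiffRange_two_mul_add_one {X : Type*} {f : ℕ → Set X} {k : ℕ}
    (hf : ∀ i j, i ≤ j → j < 2 * k + 1 → f j ⊆ f i) :
    symmDiffRange f (2 * k + 1) =
      (⋃ i ∈ Finset.range k, f (2 * i) \ f (2 * i + 1)) ∪ f (2 * k) := by
  rw [symmDiffRange, symmDiffRange_two_mul fun i j hij hj => hf i j hij (by lia),
    symmDiff_iUnion_sdiff_eq_union fun i hi => hf _ _ (by lia) (by lia)]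

/-- Normal form for the boolean hierarchy over a class `C` closed under finite
union and intersection (0-indexed: `f i` is `L_{i+1}` of the paper):
(a) `L ∈ C(2k−1)` iff there is a decreasing chain `L₁ ⊇ ⋯ ⊇ L_{2k−1}` in `C`
with `L = ⋃_{i=1}^{k−1} (L_{2i−1} \ L_{2i}) ∪ L_{2k−1}`;
(b) `L ∈ C(2k)` iff there is a decreasing chain `L₁ ⊇ ⋯ ⊇ L_{2k}` in `C`
with `L = ⋃_{i=1}^{k} (L_{2i−1} \ L_{2i})`. -/
theorem stmt19 {X : Type*} (C : Set (Set X))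
    (hUnion : ∀ P ∈ C, ∀ Q ∈ C, P ∪ Q ∈ C)
    (hInter : ∀ P ∈ C, ∀ Q ∈ C, P ∩ Q ∈ C)
    (k : ℕ) (hk : 1 ≤ k) (L : Set X) :
    (L ∈ boolLevel C (2 * k - 1) ↔
      ∃ f : ℕ → Set X, (∀ i < 2 * k - 1, f i ∈ C) ∧
        (∀ i j, i ≤ j → j < 2 * k - 1 → f j ⊆ f i) ∧
        L = (⋃ i ∈ Finset.range (k - 1), f (2 * i) \ f (2 * i + 1)) ∪ f (2 * k - 2)) ∧
    (L ∈ boolLevel C (2 * k) ↔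
      ∃ f : ℕ → Set X, (∀ i < 2 * k, f i ∈ C) ∧
        (∀ i j, i ≤ j → j < 2 * k → f j ⊆ f i) ∧
        L = ⋃ i ∈ Finset.range k, f (2 * i) \ f (2 * i + 1)) := by
  constructor
  · obtain ⟨m, rfl⟩ := Nat.exists_eq_add_of_le' hk
    rw [show 2 * (m + 1) - 1 = 2 * m + 1 by lia, show 2 * (m + 1) - 2 = 2 * m by lia,
      Nat.add_sub_cancel, mem_boolLevel_iff_exists_chain hUnion hInter]
    refine exists_congr fun f => and_congr_right fun _ => and_congr_right fun hf => ?_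
    rw [symmDiffRange_two_mul_add_one hf]
  · rw [mem_boolLevel_iff_exists_chain hUnion hInter]
    refine exists_congr fun f => and_congr_right fun _ => and_congr_right fun hf => ?_
    rw [symmDiffRange_two_mul hf]
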